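/- Let L ≥ 1 and let x ∈ F(λ) satisfy x_k = 0 for all k > L. Then ε_{i_L}(x) ≥ x_L, the element ẽ_{i_L}^{ε_{i_L}(x)}(x) is nonzero, and every entry of ẽ_{i_L}^{ε_{i_L}(x)}(x) at a position k ≥ L is 0. -/

import Mathlib

noncomputable section

namespace PaperNakashima

variable {I : Type*} [DecidableEq I]

/-- `σ_k(x) = x_k + Σ_{j>k} a_{i_k i_j} x_j`. -/
def sig (A : I → I → ℤ) (ι : ℕ → I) (k : ℕ) (x : ℕ →₀ ℤ) : ℤ :=
  x k + ∑ j ∈ x.support.filter (fun j => k < j), A (ι k) (ι j) * x j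

/-- `σ_0^{(i)}(x) = -λ_i + Σ_{j≥1} a_{i i_j} x_j`. -/
def sig0 (A : I → I → ℤ) (ι : ℕ → I) (lam : I → ℤ) (i : I) (x : ℕ →₀ ℤ) : ℤ :=
  -lam i + ∑ j ∈ x.support.filter (fun j => 1 ≤ j), A i (ι j) * x j

/-- `σ^{(i)}(x) = max_{k ≥ 1, i_k = i} σ_k(x)`. -/
def sigMax (A : I → I → ℤ) (ι : ℕ → I) (i : I) (x : ℕ →₀ ℤ) : ℤ :=
  sSup ((fun k => sig A ι k x) '' {k | 1 ≤ k ∧ ι k = i})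

/-- `M^{(i)}(x) = {k ≥ 1 : i_k = i, σ_k(x) = σ^{(i)}(x)}`. -/
def Mset (A : I → I → ℤ) (ι : ℕ → I) (i : I) (x : ℕ →₀ ℤ) : Set ℕ :=
  {k | 1 ≤ k ∧ ι k = i ∧ sig A ι k x = sigMax A ι i x}

/-- The Kashiwara operator `f̃_i` on `ℤ^∞_ι[λ] ⊔ {0}`, with `none` playing the role of `0`. -/
def ftil (A : I → I → ℤ) (ι : ℕ → I) (lam : I → ℤ) (i : I) :
    Option (ℕ →₀ ℤ) → Option (ℕ →₀ ℤ)
  | none => none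
  | some x =>
    if sig0 A ι lam i x < sigMax A ι i x then
      some (x + Finsupp.single (sInf (Mset A ι i x)) 1)
    else none

/-- The Kashiwara operator `ẽ_i` on `ℤ^∞_ι[λ] ⊔ {0}`. -/
def etil (A : I → I → ℤ) (ι : ℕ → I) (lam : I → ℤ) (i : I) :
    Option (ℕ →₀ ℤ) → Option (ℕ →₀ ℤ)
  | none => none
  | some x =>
    if 0 < sigMax A ι i x ∧ sig0 A ι lam i x ≤ sigMax A ι i x then
      some (x - Finsupp.single (sSup (Mset A ι i x)) 1)
    else none

/-- `ε_i(x) = max(σ^{(i)}(x), σ_0^{(i)}(x))`. -/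
def eps (A : I → I → ℤ) (ι : ℕ → I) (lam : I → ℤ) (i : I) (x : ℕ →₀ ℤ) : ℤ :=
  max (sigMax A ι i x) (sig0 A ι lam i x)

/-- `φ_i(x) = ε_i(x) - σ_0^{(i)}(x) = ⟨h_i, wt(x)⟩ + ε_i(x)`. -/
def phi (A : I → I → ℤ) (ι : ℕ → I) (lam : I → ℤ) (i : I) (x : ℕ →₀ ℤ) : ℤ :=
  eps A ι lam i x - sig0 A ι lam i x

/-- `F(λ)`: the image of `B(λ)` under the Kashiwara embedding, i.e. all nonzero elements
obtained from the highest weight element `0̄` by applying Kashiwara operators `f̃`. -/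
def FSet (A : I → I → ℤ) (ι : ℕ → I) (lam : I → ℤ) : Set (ℕ →₀ ℤ) :=
  {x | ∃ l : List I, List.foldl (fun y i => ftil A ι lam i y) (some 0) l = some x}

/-- The Demazure subsets `D_k`: `D_0 = {0̄}` and
`D_k = { f̃_{i_k}^m(x) : m ≥ 0, x ∈ D_{k-1} } \ {0}`. -/
def Dem (A : I → I → ℤ) (ι : ℕ → I) (lam : I → ℤ) : ℕ → Set (ℕ →₀ ℤ)
  | 0 => {0}
  | (k+1) => {y | ∃ m : ℕ, ∃ x ∈ Dem A ι lam k,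
      (ftil A ι lam (ι (k+1)))^[m] (some x) = some y}

/-- The Coxeter matrix entry attached to a generalized Cartan matrix:
`m_{ij} = 2, 3, 4, 6, ∞(=0)` according as `a_{ij} a_{ji} = 0, 1, 2, 3, ≥ 4`. -/
def coxEntry (A : I → I → ℤ) (i j : I) : ℕ :=
  if i = j then 1
  else if A i j * A j i = 0 then 2
  else if A i j * A j i = 1 then 3
  else if A i j * A j i = 2 then 4
  else if A i j * A j i = 3 then 6
  else 0

/-- The Coxeter matrix of the Weyl group of a generalized Cartan matrix `A`. -/
def coxOf (A : I → I → ℤ) : CoxeterMatrix I where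
  M := Matrix.of fun i j => coxEntry A i j
  isSymm := by
    ext i j
    by_cases h : i = j
    · simp [coxEntry, h]
    · simp only [Matrix.transpose_apply, Matrix.of_apply, coxEntry, if_neg h,
        if_neg (Ne.symm h), mul_comm (A i j) (A j i)]
  diagonal i := by simp [coxEntry]
  off_diagonal i j h := by
    simp only [Matrix.of_apply, coxEntry, if_neg h]
    split_ifs <;> decide

/-- The word `i_L, i_{L-1}, …, i_1` (the first `L` letters of `ι`, read backwards). -/
def demWord (ι : ℕ → I) (L : ℕ) : List I :=
  (List.range L).map (fun k => ι (L - k))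

section

omit [DecidableEq I]

theorem sig_eq_sum (A : I → I → ℤ) (ι : ℕ → I) (k : ℕ) (x : ℕ →₀ ℤ) :
    sig A ι k x = x k + x.sum fun j c => if k < j then A (ι k) (ι j) * c else 0 := by
  rw [sig, Finset.sum_filter, Finsupp.sum]

theorem sig0_eq_sum (A : I → I → ℤ) (ι : ℕ → I) (lam : I → ℤ) (i : I) (x : ℕ →₀ ℤ) :
    sig0 A ι lam i x = -lam i + x.sum fun j c => if 1 ≤ j then A i (ι j) * c else 0 := by
  rw [sig0, Finset.sum_filter, Finsupp.sum]

theorem sig_add_single (A : I → I → ℤ) (ι : ℕ → I) (k m : ℕ) (c : ℤ) (x : ℕ →₀ ℤ) :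
    sig A ι k (x + Finsupp.single m c) = sig A ι k x +
      ((if m = k then c else 0) + if k < m then A (ι k) (ι m) * c else 0) := by
  rw [sig_eq_sum, sig_eq_sum, Finsupp.sum_add_index', Finsupp.sum_single_index]
  · simp only [Finsupp.add_apply, Finsupp.single_apply]
    ring
  · simp
  · simp
  · intro j a b
    split_ifs <;> ring

theorem sig0_add_single (A : I → I → ℤ) (ι : ℕ → I) (lam : I → ℤ) (i : I) {m : ℕ} (hm : 1 ≤ m)
    (c : ℤ) (x : ℕ →₀ ℤ) :
    sig0 A ι lam i (x + Finsupp.single m c) = sig0 A ι lam i x + A i (ι m) * c := by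
  rw [sig0_eq_sum, sig0_eq_sum, Finsupp.sum_add_index', Finsupp.sum_single_index]
  · simp only [hm, if_true]
    ring
  · simp
  · simp
  · intro j a b
    split_ifs <;> ring

theorem sig_eq_apply (A : I → I → ℤ) (ι : ℕ → I) {k : ℕ} {x : ℕ →₀ ℤ}
    (h : ∀ j, k < j → x j = 0) : sig A ι k x = x k := by
  rw [sig, Finset.sum_eq_zero, add_zero]
  intro j hj
  rw [h j (Finset.mem_filter.mp hj).2, mul_zero]

theorem sig_eq_zero (A : I → I → ℤ) (ι : ℕ → I) {N k : ℕ} {x : ℕ →₀ ℤ}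
    (h : ∀ j, N < j → x j = 0) (hk : N < k) : sig A ι k x = 0 := by
  rw [sig_eq_apply A ι fun j hj => h j (hk.trans hj), h k hk]

theorem exists_forall_gt_eq_zero (x : ℕ →₀ ℤ) : ∃ N, ∀ j, N < j → x j = 0 :=
  ⟨x.support.sup id, fun j hj => by
    by_contra h
    exact absurd (Finset.le_sup (f := id) (Finsupp.mem_support_iff.mpr h)) (not_le.mpr hj)⟩

theorem finite_sig_image (A : I → I → ℤ) (ι : ℕ → I) (s : Set ℕ) (x : ℕ →₀ ℤ) :
    ((fun k => sig A ι k x) '' s).Finite := by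
  obtain ⟨N, hN⟩ := exists_forall_gt_eq_zero x
  refine (((Set.finite_Iic N).image fun k => sig A ι k x).insert 0).subset ?_
  rintro _ ⟨k, -, rfl⟩
  rcases le_or_gt k N with h | h
  · exact Or.inr ⟨k, h, rfl⟩
  · exact Or.inl (sig_eq_zero A ι hN h)

theorem sig_le_sigMax (A : I → I → ℤ) (ι : ℕ → I) {i : I} {k : ℕ} (hk : 1 ≤ k) (hi : ι k = i)
    (x : ℕ →₀ ℤ) : sig A ι k x ≤ sigMax A ι i x :=
  le_csSup (finite_sig_image A ι _ x).bddAbove ⟨k, ⟨hk, hi⟩, rfl⟩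

theorem Mset_nonempty (A : I → I → ℤ) (ι : ℕ → I) {i : I} (h : ∃ k, 1 ≤ k ∧ ι k = i)
    (x : ℕ →₀ ℤ) : (Mset A ι i x).Nonempty := by
  have hne : ((fun k => sig A ι k x) '' {k | 1 ≤ k ∧ ι k = i}).Nonempty := Set.Nonempty.image _ h
  obtain ⟨k, ⟨hk, hi⟩, he⟩ := hne.csSup_mem (finite_sig_image A ι _ x)
  exact ⟨k, hk, hi, he⟩

theorem le_of_mem_Mset (A : I → I → ℤ) (ι : ℕ → I) {i : I} {x : ℕ →₀ ℤ} {N k : ℕ}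
    (hN : ∀ j, N < j → x j = 0) (hpos : 0 < sigMax A ι i x) (hk : k ∈ Mset A ι i x) : k ≤ N := by
  by_contra! h
  rw [← hk.2.2, sig_eq_zero A ι hN h] at hpos
  exact lt_irrefl _ hpos

theorem sSup_mem_Mset (A : I → I → ℤ) (ι : ℕ → I) {i : I} (h : ∃ k, 1 ≤ k ∧ ι k = i)
    {x : ℕ →₀ ℤ} (hpos : 0 < sigMax A ι i x) : sSup (Mset A ι i x) ∈ Mset A ι i x := by
  obtain ⟨N, hN⟩ := exists_forall_gt_eq_zero x
  exact Nat.sSup_mem (Mset_nonempty A ι h x) ⟨N, fun k hk => le_of_mem_Mset A ι hN hpos hk⟩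

theorem sigMax_sub_single_sSup (A : I → I → ℤ) (hAdiag : ∀ i, A i i = 2) (ι : ℕ → I) {i : I}
    (h : ∃ k, 1 ≤ k ∧ ι k = i) {x : ℕ →₀ ℤ} (hpos : 0 < sigMax A ι i x) :
    sigMax A ι i (x - Finsupp.single (sSup (Mset A ι i x)) 1) = sigMax A ι i x - 1 := by
  obtain ⟨N, hN⟩ := exists_forall_gt_eq_zero x
  have hbdd : BddAbove (Mset A ι i x) := ⟨N, fun k hk => le_of_mem_Mset A ι hN hpos hk⟩
  obtain ⟨hm1, hmi, hms⟩ := sSup_mem_Mset A ι h hpos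
  have hmax : ∀ k ∈ Mset A ι i x, k ≤ sSup (Mset A ι i x) := fun k hk => le_csSup hbdd hk
  generalize sSup (Mset A ι i x) = m at *
  rw [sub_eq_add_neg, ← Finsupp.single_neg]
  apply le_antisymm
  · obtain ⟨k, hk1, hki, hks⟩ := Mset_nonempty A ι h (x + Finsupp.single m (-1))
    rw [← hks, sig_add_single, hki, hmi, hAdiag]
    have hle := sig_le_sigMax A ι hk1 hki x
    rcases lt_trichotomy k m with hkm | hkm | hkm
    · rw [if_neg hkm.ne', if_pos hkm]
      linarith
    · rw [if_pos hkm.symm, if_neg hkm.not_lt]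
      linarith
    · have hne : sig A ι k x ≠ sigMax A ι i x := fun he =>
        absurd (hmax k ⟨hk1, hki, he⟩) (not_le.mpr hkm)
      rw [if_neg hkm.ne, if_neg hkm.not_gt]
      have := lt_of_le_of_ne hle hne
      linarith
  · refine le_trans (le_of_eq ?_) (sig_le_sigMax A ι hm1 hmi _)
    rw [sig_add_single, if_pos rfl, if_neg (lt_irrefl m), hms]
    ring

theorem sig0_le_sigMax_add_single (A : I → I → ℤ) (hAdiag : ∀ i, A i i = 2)
    (hAoff : ∀ i j, i ≠ j → A i j ≤ 0) (ι : ℕ → I) (hι : ∀ i, ∃ k, 1 ≤ k ∧ ι k = i)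
    (lam : I → ℤ) {j : I} {x : ℕ →₀ ℤ} (hx : ∀ i, sig0 A ι lam i x ≤ sigMax A ι i x)
    (hj : sig0 A ι lam j x < sigMax A ι j x) {m : ℕ} (hm : m ∈ Mset A ι j x) (i : I) :
    sig0 A ι lam i (x + Finsupp.single m 1) ≤ sigMax A ι i (x + Finsupp.single m 1) := by
  obtain ⟨hm1, hmj, hms⟩ := hm
  rw [sig0_add_single A ι lam i hm1, hmj]
  by_cases hij : i = j
  · subst hij
    refine le_trans ?_ (sig_le_sigMax A ι hm1 hmj _)
    rw [sig_add_single, if_pos rfl, if_neg (lt_irrefl m), hms, hAdiag]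
    linarith
  · obtain ⟨k, hk1, hki, hks⟩ := Mset_nonempty A ι (hι i) x
    have hmk : m ≠ k := by
      rintro rfl
      exact hij (hki.symm.trans hmj)
    refine le_trans ?_ (sig_le_sigMax A ι hk1 hki _)
    rw [sig_add_single, if_neg hmk, hki, hmj, hks]
    have h1 := hAoff i j hij
    have h2 := hx i
    split_ifs <;> linarith

theorem sig0_le_sigMax_and_nonneg_of_mem_FSet (A : I → I → ℤ) (hAdiag : ∀ i, A i i = 2)
    (hAoff : ∀ i j, i ≠ j → A i j ≤ 0) (ι : ℕ → I) (hι : ∀ i, ∃ k, 1 ≤ k ∧ ι k = i)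
    (lam : I → ℤ) (hlam : ∀ i, 0 ≤ lam i) {x : ℕ →₀ ℤ} (hx : x ∈ FSet A ι lam) :
    (∀ i, sig0 A ι lam i x ≤ sigMax A ι i x) ∧ ∀ k, 0 ≤ x k := by
  obtain ⟨l, hl⟩ := hx
  induction l using List.reverseRecOn generalizing x with
  | nil =>
    obtain rfl : 0 = x := Option.some.inj hl
    refine ⟨fun i => ?_, fun k => le_rfl⟩
    obtain ⟨k, hk, hki⟩ := hι i
    refine le_trans ?_ (sig_le_sigMax A ι hk hki 0)
    simpa [sig, sig0] using hlam i
  | append_singleton l j ih =>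
    rw [List.foldl_concat] at hl
    cases hz : List.foldl (fun y i => ftil A ι lam i y) (some 0) l with
    | none => simp [hz, ftil.eq_1] at hl
    | some z =>
      obtain ⟨hmax, hnn⟩ := ih hz
      rw [hz, ftil.eq_2] at hl
      split_ifs at hl with hj
      obtain rfl := Option.some.inj hl
      refine ⟨sig0_le_sigMax_add_single A hAdiag hAoff ι hι lam hmax hj
        (Nat.sInf_mem (Mset_nonempty A ι (hι j) z)), fun k => ?_⟩
      rw [Finsupp.add_apply, Finsupp.single_apply]
      have := hnn k
      split_ifs <;> linarith

theorem exists_etil_iterate_eq_some (A : I → I → ℤ) (hAdiag : ∀ i, A i i = 2) (ι : ℕ → I)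
    (lam : I → ℤ) {L : ℕ} (hL : 1 ≤ L) (n : ℕ) {x : ℕ →₀ ℤ}
    (hn : sigMax A ι (ι L) x = n) (hx0 : sig0 A ι lam (ι L) x ≤ sigMax A ι (ι L) x)
    (hnn : 0 ≤ x L) (hxL : ∀ k, L < k → x k = 0) :
    ∃ y : ℕ →₀ ℤ, (etil A ι lam (ι L))^[n] (some x) = some y ∧ ∀ k, L ≤ k → y k = 0 := by
  induction n generalizing x with
  | zero =>
    refine ⟨x, rfl, fun k hk => ?_⟩
    rcases hk.eq_or_lt with rfl | hk
    · have := sig_le_sigMax A ι hL rfl x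
      rw [sig_eq_apply A ι hxL, hn] at this
      exact le_antisymm this hnn
    · exact hxL k hk
  | succ n ih =>
    have hpos : 0 < sigMax A ι (ι L) x := by omega
    have hex : ∃ k, 1 ≤ k ∧ ι k = ι L := ⟨L, hL, rfl⟩
    have hstep := sigMax_sub_single_sSup A hAdiag ι hex hpos
    have hmem := sSup_mem_Mset A ι hex hpos
    have hmL := le_of_mem_Mset A ι hxL hpos hmem
    rw [Function.iterate_succ_apply]
    simp only [etil, if_pos (And.intro hpos hx0)]
    generalize sSup (Mset A ι (ι L) x) = m at *
    obtain ⟨hm1, hmi, hms⟩ := hmem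
    apply ih
    · rw [hstep, hn]
      push_cast
      ring
    · rw [hstep, sub_eq_add_neg, ← Finsupp.single_neg, sig0_add_single A ι lam _ hm1, hmi, hAdiag]
      linarith
    · rw [Finsupp.sub_apply, Finsupp.single_apply]
      split_ifs with h
      · subst h
        rw [sig_eq_apply A ι hxL] at hms
        omega
      · simpa using hnn
    · intro k hk
      rw [Finsupp.sub_apply, Finsupp.single_apply, if_neg (by omega), hxL k hk, sub_zero]

end

/-- If `x ∈ F(λ)` satisfies `x_k = 0` for all `k > L` (`L ≥ 1`), then
`ε_{i_L}(x) ≥ x_L`, the element `ẽ_{i_L}^{ε_{i_L}(x)}(x)` is nonzero, and all of its entries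
in positions `k ≥ L` vanish. -/
theorem etil_max_string {I : Type*} [Fintype I] [DecidableEq I]
    (A : I → I → ℤ)
    (hAdiag : ∀ i, A i i = 2)
    (hAoff : ∀ i j, i ≠ j → A i j ≤ 0)
    (hAzero : ∀ i j, A i j = 0 ↔ A j i = 0)
    (hAsym : ∃ d : I → ℤ, (∀ i, 0 < d i) ∧ ∀ i j, d i * A i j = d j * A j i)
    (ι : ℕ → I)
    (hι₁ : ∀ k, 1 ≤ k → ι k ≠ ι (k + 1))
    (hι₂ : ∀ i : I, {k : ℕ | 1 ≤ k ∧ ι k = i}.Infinite)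
    (lam : I → ℤ) (hlam : ∀ i, 0 ≤ lam i)
    (L : ℕ) (hL : 1 ≤ L)
    (x : ℕ →₀ ℤ) (hx : x ∈ FSet A ι lam) (hxL : ∀ k, L < k → x k = 0) :
    x L ≤ eps A ι lam (ι L) x ∧
      ∃ y : ℕ →₀ ℤ,
        (etil A ι lam (ι L))^[(eps A ι lam (ι L) x).toNat] (some x) = some y ∧
          ∀ k, L ≤ k → y k = 0 := by
  have hι : ∀ i, ∃ k, 1 ≤ k ∧ ι k = i := fun i => (hι₂ i).nonempty
  obtain ⟨hmax, hnn⟩ := sig0_le_sigMax_and_nonneg_of_mem_FSet A hAdiag hAoff ι hι lam hlam hx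
  have heps : eps A ι lam (ι L) x = sigMax A ι (ι L) x := max_eq_left (hmax _)
  have hle : x L ≤ sigMax A ι (ι L) x := by
    rw [← sig_eq_apply A ι hxL]
    exact sig_le_sigMax A ι hL rfl x
  rw [heps]
  exact ⟨hle, exists_etil_iterate_eq_some A hAdiag ι lam hL _
    (Int.toNat_of_nonneg ((hnn L).trans hle)).symm (hmax _) (hnn L) hxL⟩

end PaperNakashima
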